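/- arXiv:1909.00294 — 4 statements merged into one kernel-verified Lean document; each statement's English description precedes it below -/
import Mathlib

section
/- Under the stated second-order heavy-tailed specification, let η > 0 and let (u_n) and (T_n) be sequences with u_n → ∞, T_n → ∞, and T_n^{−η}·log u_n → 0. Then 1 − F(x_0, u_n) > 0 for all sufficiently large n, and T_n^{−η} · sup{ ‖∇_x F(x, u_n)‖ : ‖x − x_0‖ ≤ T_n^{−η} } / (1 − F(x_0, u_n)) → 0 as n → ∞. -/
open Filter Real

/-- The second-order heavy-tailed specification
`F(x,y) = 1 − c(x)·y^{−γ(x)}·(1 + d(x)·y^{−γ̃(x)} + r(x,y))` (Condition B(i) of the paper). -/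
noncomputable def heavyTailCDF {p : ℕ} (c d γ γt : EuclideanSpace ℝ (Fin p) → ℝ)
    (r : EuclideanSpace ℝ (Fin p) → ℝ → ℝ) (x : EuclideanSpace ℝ (Fin p)) (y : ℝ) : ℝ :=
  1 - c x * y ^ (-γ x) * (1 + d x * y ^ (-γt x) + r x y)

section GradientBounds

variable {E : Type*} [NormedAddCommGroup E] [NormedSpace ℝ E]

theorem norm_fderiv_mul_le {f g : E → ℝ} {x : E} (hf : DifferentiableAt ℝ f x)
    (hg : DifferentiableAt ℝ g x) :
    ‖fderiv ℝ (fun x => f x * g x) x‖ ≤ |f x| * ‖fderiv ℝ g x‖ + |g x| * ‖fderiv ℝ f x‖ := by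
  rw [fderiv_fun_mul hf hg]
  refine (norm_add_le _ _).trans_eq ?_
  simp only [norm_smul, Real.norm_eq_abs]

theorem hasFDerivAt_const_rpow_neg {g : E → ℝ} {x : E} {y : ℝ} (hy : 0 < y)
    (hg : DifferentiableAt ℝ g x) :
    HasFDerivAt (fun x => y ^ (-g x)) ((y ^ (-g x) * Real.log y) • (-fderiv ℝ g x)) x :=
  hg.hasFDerivAt.neg.const_rpow hy

theorem norm_fderiv_const_rpow_neg {g : E → ℝ} {x : E} {y : ℝ} (hy : 1 ≤ y)
    (hg : DifferentiableAt ℝ g x) :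
    ‖fderiv ℝ (fun x => y ^ (-g x)) x‖ = y ^ (-g x) * Real.log y * ‖fderiv ℝ g x‖ := by
  have hy0 : 0 < y := by linarith
  have hl : 0 ≤ Real.log y := Real.log_nonneg hy
  rw [(hasFDerivAt_const_rpow_neg hy0 hg).fderiv, norm_smul, norm_neg, Real.norm_eq_abs,
    abs_of_nonneg (by positivity)]

/-- If all the coefficients and their gradients are bounded by `M`, the gradient of the tail
is at most a constant multiple of `y ^ (-γ x) * (1 + log y)`. -/
theorem norm_fderiv_heavyTail_le {c d γ γt r : E → ℝ} {x : E} {y M : ℝ} (hy : 1 ≤ y)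
    (hc : DifferentiableAt ℝ c x) (hd : DifferentiableAt ℝ d x)
    (hγ : DifferentiableAt ℝ γ x) (hγt : DifferentiableAt ℝ γt x)
    (hr : DifferentiableAt ℝ r x) (hγtpos : 0 ≤ γt x)
    (hcM : |c x| ≤ M) (hc'M : ‖fderiv ℝ c x‖ ≤ M) (hdM : |d x| ≤ M)
    (hd'M : ‖fderiv ℝ d x‖ ≤ M) (hγM : ‖fderiv ℝ γ x‖ ≤ M) (hγtM : ‖fderiv ℝ γt x‖ ≤ M)
    (hr1 : |r x| ≤ 1) (hr'1 : ‖fderiv ℝ r x‖ ≤ 1) :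
    ‖fderiv ℝ (fun x => 1 - c x * y ^ (-γ x) * (1 + d x * y ^ (-γt x) + r x)) x‖ ≤
      y ^ (-γ x) * ((2 * M ^ 3 + 2 * M ^ 2 + 3 * M) * (1 + Real.log y)) := by
  have hy0 : 0 < y := by linarith
  have hl : 0 ≤ Real.log y := Real.log_nonneg hy
  have hM : 0 ≤ M := (abs_nonneg _).trans hcM
  have hP := (hasFDerivAt_const_rpow_neg hy0 hγ).differentiableAt
  have hR := (hasFDerivAt_const_rpow_neg hy0 hγt).differentiableAt
  have hPn := norm_fderiv_const_rpow_neg hy hγ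
  have hRn := norm_fderiv_const_rpow_neg hy hγt
  have hP0 : 0 ≤ y ^ (-γ x) := by positivity
  have hR0 : 0 ≤ y ^ (-γt x) := by positivity
  have hR1 : y ^ (-γt x) ≤ 1 := Real.rpow_le_one_of_one_le_of_nonpos hy (by linarith)
  have hdR := hd.fun_mul hR
  have hQ : DifferentiableAt ℝ (fun x => 1 + d x * y ^ (-γt x) + r x) x :=
    (hdR.const_add 1).fun_add hr
  have hcP := hc.fun_mul hP
  have hQn : ‖fderiv ℝ (fun x => 1 + d x * y ^ (-γt x) + r x) x‖ ≤
      M * (Real.log y * M) + M + 1 := by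
    rw [fderiv_fun_add (hdR.const_add 1) hr, fderiv_const_add]
    refine (norm_add_le _ _).trans (add_le_add ?_ hr'1)
    refine (norm_fderiv_mul_le hd hR).trans ?_
    rw [hRn, abs_of_nonneg hR0]
    have h1 : y ^ (-γt x) * Real.log y * ‖fderiv ℝ γt x‖ ≤ 1 * Real.log y * M := by gcongr
    have h2 : y ^ (-γt x) * ‖fderiv ℝ d x‖ ≤ 1 * M := by gcongr
    have h3 : |d x| * (y ^ (-γt x) * Real.log y * ‖fderiv ℝ γt x‖) ≤
        M * (1 * Real.log y * M) := by gcongr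
    linarith
  have hQa : |1 + d x * y ^ (-γt x) + r x| ≤ 2 + M := by
    refine (abs_add_three _ _ _).trans ?_
    rw [abs_mul, abs_of_nonneg hR0, abs_one]
    have : |d x| * y ^ (-γt x) ≤ M * 1 := by gcongr
    linarith
  have hcPn : ‖fderiv ℝ (fun x => c x * y ^ (-γ x)) x‖ ≤
      y ^ (-γ x) * (M * (Real.log y * M) + M) := by
    refine (norm_fderiv_mul_le hc hP).trans ?_
    rw [hPn, abs_of_nonneg hP0]
    have h1 : |c x| * (y ^ (-γ x) * Real.log y * ‖fderiv ℝ γ x‖) ≤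
        M * (y ^ (-γ x) * Real.log y * M) := by gcongr
    have h2 : y ^ (-γ x) * ‖fderiv ℝ c x‖ ≤ y ^ (-γ x) * M := by gcongr
    linarith
  rw [fderiv_const_sub, norm_neg]
  refine (norm_fderiv_mul_le hcP hQ).trans ?_
  rw [abs_mul, abs_of_nonneg hP0]
  calc _ ≤ M * y ^ (-γ x) * (M * (Real.log y * M) + M + 1) +
        (2 + M) * (y ^ (-γ x) * (M * (Real.log y * M) + M)) := by gcongr
    _ = y ^ (-γ x) * ((2 * M ^ 3 + 2 * M ^ 2) * Real.log y + (2 * M ^ 2 + 3 * M)) := by ring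
    _ ≤ _ := by
      gcongr
      nlinarith [pow_nonneg hM 3, mul_nonneg hM hl]

theorem rpow_neg_le_of_norm_fderiv_le {γ : E → ℝ} {x₀ x : E} {δ y M t : ℝ} (hy : 1 ≤ y)
    (hγ : Differentiable ℝ γ)
    (hγM : ∀ x ∈ Metric.closedBall x₀ δ, ‖fderiv ℝ γ x‖ ≤ M) (hM : 0 ≤ M)
    (htδ : t ≤ δ) (hx : x ∈ Metric.closedBall x₀ t) :
    y ^ (-γ x) ≤ y ^ (-γ x₀) * Real.exp (M * (t * Real.log y)) := by
  have hy0 : 0 < y := by linarith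
  have hl : 0 ≤ Real.log y := Real.log_nonneg hy
  have hxδ := Metric.closedBall_subset_closedBall htδ hx
  have hx₀ : x₀ ∈ Metric.closedBall x₀ δ :=
    Metric.mem_closedBall_self (dist_nonneg.trans (Metric.mem_closedBall.1 hxδ))
  have h := (convex_closedBall x₀ δ).norm_image_sub_le_of_norm_fderiv_le
    (fun z _ => hγ z) hγM hxδ hx₀
  rw [Metric.mem_closedBall, dist_comm, dist_eq_norm] at hx
  have h' : γ x₀ - γ x ≤ M * t :=
    (le_abs_self _).trans (h.trans (mul_le_mul_of_nonneg_left hx hM))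
  rw [Real.rpow_def_of_pos hy0, Real.rpow_def_of_pos hy0, ← Real.exp_add]
  refine Real.exp_le_exp.2 ?_
  nlinarith [mul_le_mul_of_nonneg_left h' hl]

end GradientBounds

theorem half_mul_rpow_le_heavyTail {c₁ c₀ d₀ g gt ρ y : ℝ} (hy : 0 < y) (hc₁ : 0 ≤ c₁)
    (hc : c₁ ≤ c₀) (hd : |d₀ * y ^ (-gt)| ≤ 1 / 4) (hρ : |ρ| ≤ 1 / 4) :
    c₁ / 2 * y ^ (-g) ≤ 1 - (1 - c₀ * y ^ (-g) * (1 + d₀ * y ^ (-gt) + ρ)) := by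
  have hP : 0 < y ^ (-g) := by positivity
  have h1 : (1 : ℝ) / 2 ≤ 1 + d₀ * y ^ (-gt) + ρ := by
    linarith [neg_le_of_abs_le hd, neg_le_of_abs_le hρ]
  calc c₁ / 2 * y ^ (-g) = c₁ * y ^ (-g) * (1 / 2) := by ring
    _ ≤ c₀ * y ^ (-g) * (1 + d₀ * y ^ (-gt) + ρ) := by
      have : 0 ≤ c₀ := hc₁.trans hc
      gcongr
    _ = _ := by ring

theorem le_of_mul_rpow_le {a y s b : ℝ} (ha : 0 ≤ a) (hy : 1 ≤ y) (hs : 0 ≤ s)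
    (h : a * y ^ s ≤ b) : a ≤ b :=
  (le_mul_of_one_le_right ha (Real.one_le_rpow hy hs)).trans h

/-- Lemma 2(a) of the paper in the heavy-tailed case: under Condition B(i), for thresholds
`u_n → ∞` with `T_n^{−η}·log u_n → 0`, eventually `1 − F(x_0, u_n) > 0` and
`T_n^{−η}·sup_{‖x−x_0‖ ≤ T_n^{−η}} ‖∇_x F(x, u_n)‖ / (1 − F(x_0, u_n)) → 0`. -/
theorem stmt_8 (p : ℕ) (hp : 1 ≤ p) (x0 : EuclideanSpace ℝ (Fin p)) (δ : ℝ) (hδ : 0 < δ)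
    (c d γ γt : EuclideanSpace ℝ (Fin p) → ℝ)
    (r : EuclideanSpace ℝ (Fin p) → ℝ → ℝ)
    (hc : ContDiff ℝ 1 c) (hd : ContDiff ℝ 1 d)
    (hγ : ContDiff ℝ 1 γ) (hγt : ContDiff ℝ 1 γt)
    (hcbd : ∃ c₁ c₂ : ℝ, 0 < c₁ ∧ 0 < c₂ ∧
      ∀ x ∈ Metric.closedBall x0 δ, c₁ ≤ c x ∧ c x ≤ c₂)
    (hcgrad : ∃ C : ℝ, ∀ x ∈ Metric.closedBall x0 δ, ‖fderiv ℝ c x‖ ≤ C)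
    (hdbd : ∃ C : ℝ, ∀ x ∈ Metric.closedBall x0 δ, |d x| ≤ C)
    (hdgrad : ∃ C : ℝ, ∀ x ∈ Metric.closedBall x0 δ, ‖fderiv ℝ d x‖ ≤ C)
    (hγpos : ∀ x ∈ Metric.closedBall x0 δ, 0 < γ x)
    (hγtpos : ∀ x ∈ Metric.closedBall x0 δ, 0 < γt x)
    (hγgrad : ∃ C : ℝ, ∀ x ∈ Metric.closedBall x0 δ, ‖fderiv ℝ γ x‖ ≤ C)
    (hγtgrad : ∃ C : ℝ, ∀ x ∈ Metric.closedBall x0 δ, ‖fderiv ℝ γt x‖ ≤ C)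
    (hrx : ∀ y : ℝ, 0 < y → ContDiff ℝ 1 (fun x => r x y))
    (hr0 : ∀ ε > (0 : ℝ), ∃ y₀ : ℝ, ∀ y ≥ y₀, ∀ x ∈ Metric.closedBall x0 δ,
      |r x y| * y ^ γt x ≤ ε)
    (hr1 : ∀ ε > (0 : ℝ), ∃ y₀ : ℝ, ∀ y ≥ y₀, ∀ x ∈ Metric.closedBall x0 δ,
      ‖fderiv ℝ (fun x' => r x' y) x‖ * y ^ γt x ≤ ε)
    (η : ℝ) (hη : 0 < η) (u T : ℕ → ℝ)
    (hu : Tendsto u atTop atTop) (hT : Tendsto T atTop atTop)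
    (hTu : Tendsto (fun n => (T n) ^ (-η) * Real.log (u n)) atTop (nhds 0)) :
    (∀ᶠ n in atTop, 0 < 1 - heavyTailCDF c d γ γt r x0 (u n)) ∧
    Tendsto (fun n => (T n) ^ (-η) *
        sSup ((fun x => ‖fderiv ℝ (fun x' => heavyTailCDF c d γ γt r x' (u n)) x‖) ''
          Metric.closedBall x0 ((T n) ^ (-η))) /
        (1 - heavyTailCDF c d γ γt r x0 (u n)))
      atTop (nhds 0) := by
  obtain ⟨c₁, c₂, hc₁, -, hcB⟩ := hcbd
  obtain ⟨C₁, hC₁⟩ := hcgrad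
  obtain ⟨C₂, hC₂⟩ := hdbd
  obtain ⟨C₃, hC₃⟩ := hdgrad
  obtain ⟨C₄, hC₄⟩ := hγgrad
  obtain ⟨C₅, hC₅⟩ := hγtgrad
  obtain ⟨M, hM⟩ : ∃ M, ∀ a ∈ ({c₂, C₁, C₂, C₃, C₄, C₅} : Set ℝ), a ≤ M :=
    Set.Finite.bddAbove (by simp)
  have hx0 : x0 ∈ Metric.closedBall x0 δ := Metric.mem_closedBall_self hδ.le
  have hM0 : 0 ≤ M := (norm_nonneg _).trans ((hC₁ x0 hx0).trans (hM _ (by simp)))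
  have ht : Tendsto (fun n => (T n) ^ (-η)) atTop (nhds 0) :=
    (tendsto_rpow_neg_atTop hη).comp hT
  have htpos : ∀ᶠ n in atTop, 0 < (T n) ^ (-η) :=
    (hT.eventually_gt_atTop 0).mono fun n hn => Real.rpow_pos_of_pos hn _
  have hu1 : ∀ᶠ n in atTop, 1 ≤ u n := hu.eventually_ge_atTop 1
  have hlower : ∀ᶠ n in atTop, c₁ / 2 * (u n) ^ (-γ x0) ≤
      1 - heavyTailCDF c d γ γt r x0 (u n) := by
    have hdt : Tendsto (fun n => |d x0 * (u n) ^ (-γt x0)|) atTop (nhds 0) := by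
      simpa using
        (((tendsto_rpow_neg_atTop (hγtpos x0 hx0)).comp hu).const_mul (d x0)).abs
    obtain ⟨y₀, hy₀⟩ := hr0 (1 / 4) (by norm_num)
    filter_upwards [hu1, hdt.eventually_le_const (show (0 : ℝ) < 1 / 4 by norm_num),
      hu.eventually_ge_atTop y₀] with n h1 h2 h3
    exact half_mul_rpow_le_heavyTail (by linarith) hc₁.le (hcB x0 hx0).1 h2
      (le_of_mul_rpow_le (abs_nonneg _) h1 (hγtpos x0 hx0).le (hy₀ _ h3 x0 hx0))
  refine ⟨?_, ?_⟩
  · filter_upwards [hu1, hlower] with n h1 h2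
    have : 0 < u n := by linarith
    exact lt_of_lt_of_le (by positivity) h2
  obtain ⟨K, hK⟩ : ∃ K, K = 2 * M ^ 3 + 2 * M ^ 2 + 3 * M := ⟨_, rfl⟩
  have hK0 : 0 ≤ K := by rw [hK]; positivity
  have hlim : Tendsto (fun n => 2 * K / c₁ * ((T n) ^ (-η) + (T n) ^ (-η) * Real.log (u n)) *
      Real.exp (M * ((T n) ^ (-η) * Real.log (u n)))) atTop (nhds 0) := by
    simpa using ((ht.add hTu).const_mul (2 * K / c₁)).mul
      ((Real.continuous_exp.tendsto _).comp (hTu.const_mul M))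
  obtain ⟨y₀, hy₀⟩ := hr0 1 one_pos
  obtain ⟨y₁, hy₁⟩ := hr1 1 one_pos
  refine tendsto_of_tendsto_of_tendsto_of_le_of_le' tendsto_const_nhds hlim ?_ ?_
  · filter_upwards [hu1, hlower, htpos] with n h1 h2 h3
    have : 0 < u n := by linarith
    refine div_nonneg (mul_nonneg h3.le (Real.sSup_nonneg ?_)) (le_trans (by positivity) h2)
    rintro _ ⟨x, -, rfl⟩
    exact norm_nonneg _
  · filter_upwards [hu1, hlower, htpos, ht.eventually_le_const hδ, hu.eventually_ge_atTop y₀,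
      hu.eventually_ge_atTop y₁] with n h1 h2 h3 h4 h5 h6
    have hu0 : 0 < u n := by linarith
    have hl : 0 ≤ Real.log (u n) := Real.log_nonneg h1
    have hsup : sSup ((fun x => ‖fderiv ℝ (fun x' => heavyTailCDF c d γ γt r x' (u n)) x‖) ''
        Metric.closedBall x0 ((T n) ^ (-η))) ≤
        (u n) ^ (-γ x0) * Real.exp (M * ((T n) ^ (-η) * Real.log (u n))) *
          (K * (1 + Real.log (u n))) := by
      refine Real.sSup_le ?_ (by positivity)
      rintro _ ⟨x, hx, rfl⟩
      have hxδ := Metric.closedBall_subset_closedBall h4 hx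
      have hcx := hcB x hxδ
      have hgrad := norm_fderiv_heavyTail_le (M := M) h1
        (hc.differentiable one_ne_zero x) (hd.differentiable one_ne_zero x)
        (hγ.differentiable one_ne_zero x) (hγt.differentiable one_ne_zero x)
        ((hrx (u n) hu0).differentiable one_ne_zero x) (hγtpos x hxδ).le
        (by rw [abs_of_pos (hc₁.trans_le hcx.1)]; exact hcx.2.trans (hM _ (by simp)))
        ((hC₁ x hxδ).trans (hM _ (by simp))) ((hC₂ x hxδ).trans (hM _ (by simp)))
        ((hC₃ x hxδ).trans (hM _ (by simp))) ((hC₄ x hxδ).trans (hM _ (by simp)))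
        ((hC₅ x hxδ).trans (hM _ (by simp)))
        (le_of_mul_rpow_le (abs_nonneg _) h1 (hγtpos x hxδ).le (hy₀ _ h5 x hxδ))
        (le_of_mul_rpow_le (norm_nonneg _) h1 (hγtpos x hxδ).le (hy₁ _ h6 x hxδ))
      rw [← hK] at hgrad
      refine hgrad.trans (mul_le_mul_of_nonneg_right ?_ (by positivity))
      exact rpow_neg_le_of_norm_fderiv_le h1 (hγ.differentiable one_ne_zero)
        (fun z hz => (hC₄ z hz).trans (hM _ (by simp))) hM0 h4 hx
    have hP : 0 < (u n) ^ (-γ x0) := by positivity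
    calc _ ≤ (T n) ^ (-η) * ((u n) ^ (-γ x0) *
          Real.exp (M * ((T n) ^ (-η) * Real.log (u n))) * (K * (1 + Real.log (u n)))) /
          (c₁ / 2 * (u n) ^ (-γ x0)) := by gcongr
      _ = _ := by
        field_simp
end

section
/- Under the stated second-order bounded-endpoint specification, let η > 0 and let (u_n) and (T_n) be sequences with u_n < y_0 for all n, u_n → y_0, T_n → ∞, and T_n^{−η}·|log(y_0 − u_n)| → 0. Then 1 − F(x_0, u_n) > 0 for all sufficiently large n, and T_n^{−η} · sup{ ‖∇_x F(x, u_n)‖ : ‖x − x_0‖ ≤ T_n^{−η} } / (1 − F(x_0, u_n)) → 0 as n → ∞. -/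
open Filter Real

/-- The second-order bounded-endpoint specification
`F(x,y) = 1 − c(x)·(y_0 − y)^{−γ(x)}·(1 + d(x)·(y_0 − y)^{−γ̃(x)} + r(x,y))`
(Condition B(iii) of the paper; here `γ, γ̃ < 0` on the ball). -/
noncomputable def boundedEndCDF {p : ℕ} (y0 : ℝ) (c d γ γt : EuclideanSpace ℝ (Fin p) → ℝ)
    (r : EuclideanSpace ℝ (Fin p) → ℝ → ℝ) (x : EuclideanSpace ℝ (Fin p)) (y : ℝ) : ℝ :=
  1 - c x * (y0 - y) ^ (-γ x) * (1 + d x * (y0 - y) ^ (-γt x) + r x y)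

theorem norm_fderiv_mul_const_rpow_neg_le {E : Type*} [NormedAddCommGroup E] [NormedSpace ℝ E]
    {f g : E → ℝ} {x : E} {s : ℝ} (hs : 0 < s) (hf : DifferentiableAt ℝ f x)
    (hg : DifferentiableAt ℝ g x) :
    DifferentiableAt ℝ (fun z => f z * s ^ (-g z)) x ∧
    ‖fderiv ℝ (fun z => f z * s ^ (-g z)) x‖ ≤
      s ^ (-g x) * (‖fderiv ℝ f x‖ + |f x| * |Real.log s| * ‖fderiv ℝ g x‖) := by
  have h := hf.hasFDerivAt.mul (hg.hasFDerivAt.fun_neg.const_rpow hs)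
  refine ⟨h.differentiableAt, ?_⟩
  have hp : 0 < s ^ (-g x) := Real.rpow_pos_of_pos hs _
  refine (congrArg norm h.fderiv).trans_le ((norm_add_le _ _).trans_eq ?_)
  simp only [norm_smul, norm_neg, Real.norm_eq_abs, abs_mul, abs_of_pos hp]
  ring

theorem norm_fderiv_boundedEndCDF_le {p : ℕ} {y0 y C : ℝ}
    {c d γ γt : EuclideanSpace ℝ (Fin p) → ℝ} {r : EuclideanSpace ℝ (Fin p) → ℝ → ℝ}
    {x : EuclideanSpace ℝ (Fin p)} (hy : y < y0) (hy1 : y0 - y ≤ 1) (hC : 1 ≤ C)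
    (hc : DifferentiableAt ℝ c x) (hd : DifferentiableAt ℝ d x)
    (hγ : DifferentiableAt ℝ γ x) (hγt : DifferentiableAt ℝ γt x)
    (hr : DifferentiableAt ℝ (fun z => r z y) x) (hγt0 : γt x ≤ 0)
    (hcC : |c x| ≤ C) (hdC : |d x| ≤ C) (hrC : |r x y| ≤ 1)
    (hc' : ‖fderiv ℝ c x‖ ≤ C) (hd' : ‖fderiv ℝ d x‖ ≤ C)
    (hγ' : ‖fderiv ℝ γ x‖ ≤ C) (hγt' : ‖fderiv ℝ γt x‖ ≤ C)
    (hr' : ‖fderiv ℝ (fun z => r z y) x‖ ≤ 1) :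
    ‖fderiv ℝ (fun z => boundedEndCDF y0 c d γ γt r z y) x‖ ≤
      (y0 - y) ^ (-γ x) * (5 * C ^ 3 * (1 + |Real.log (y0 - y)|)) := by
  have hs : 0 < y0 - y := sub_pos.2 hy
  obtain ⟨hA, hA'⟩ := norm_fderiv_mul_const_rpow_neg_le hs hc hγ
  obtain ⟨hB, hB'⟩ := norm_fderiv_mul_const_rpow_neg_le hs hd hγt
  have h := (hA.hasFDerivAt.fun_mul
    ((hB.hasFDerivAt.const_add 1).fun_add hr.hasFDerivAt)).const_sub 1
  refine (congrArg norm h.fderiv).trans_le ?_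
  rw [norm_neg]
  refine (norm_add_le _ _).trans ?_
  rw [norm_smul, norm_smul, Real.norm_eq_abs, Real.norm_eq_abs, abs_mul]
  have hD : 0 < (y0 - y) ^ (-γ x) := Real.rpow_pos_of_pos hs _
  have hE : 0 < (y0 - y) ^ (-γt x) := Real.rpow_pos_of_pos hs _
  have hE1 : (y0 - y) ^ (-γt x) ≤ 1 :=
    Real.rpow_le_one hs.le hy1 (neg_nonneg.2 hγt0)
  rw [abs_of_pos hD]
  set D := (y0 - y) ^ (-γ x)
  set E := (y0 - y) ^ (-γt x)
  set L := |Real.log (y0 - y)|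
  have hL : 0 ≤ L := abs_nonneg _
  have hC0 : 0 ≤ C := zero_le_one.trans hC
  have hA2 : ‖fderiv ℝ (fun z => c z * (y0 - y) ^ (-γ z)) x‖ ≤ D * (C + C * L * C) :=
    hA'.trans (by gcongr)
  have hB2 : ‖fderiv ℝ (fun z => d z * (y0 - y) ^ (-γt z)) x‖ ≤ 1 * (C + C * L * C) :=
    hB'.trans (by gcongr)
  have hG : |1 + d x * E + r x y| ≤ 1 + C * 1 + 1 := by
    refine (abs_add_le _ _).trans (add_le_add ((abs_add_le _ _).trans ?_) hrC)
    rw [abs_one, abs_mul, abs_of_pos hE]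
    gcongr
  calc |c x| * D * ‖_‖ + |1 + d x * E + r x y| * ‖_‖
      ≤ C * D * (1 * (C + C * L * C) + 1) + (1 + C * 1 + 1) * (D * (C + C * L * C)) := by
        gcongr
        exact (norm_add_le _ _).trans (add_le_add hB2 hr')
    _ = D * (3 * C + 2 * C ^ 2 + 2 * C ^ 2 * L + 2 * C ^ 3 * L) := by ring
    _ ≤ D * (5 * C ^ 3 * (1 + L)) := by
        have h12 : C ^ 1 ≤ C ^ 3 := pow_le_pow_right₀ hC (by norm_num)
        have h23 : C ^ 2 ≤ C ^ 3 := pow_le_pow_right₀ hC (by norm_num)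
        have h3 : 0 ≤ C ^ 3 * L := by positivity
        have h4 : C ^ 2 * L ≤ C ^ 3 * L := by gcongr
        gcongr
        linarith

theorem le_one_sub_boundedEndCDF {p : ℕ} {y0 y c₁ : ℝ}
    {c d γ γt : EuclideanSpace ℝ (Fin p) → ℝ} {r : EuclideanSpace ℝ (Fin p) → ℝ → ℝ}
    {x : EuclideanSpace ℝ (Fin p)} (hy : y < y0) (hc₁ : 0 < c₁) (hc : c₁ ≤ c x)
    (hr : |r x y| ≤ (y0 - y) ^ (-γt x))
    (hsmall : (|d x| + 1) * (y0 - y) ^ (-γt x) ≤ 1 / 2) :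
    (y0 - y) ^ (-γ x) * (c₁ / 2) ≤ 1 - boundedEndCDF y0 c d γ γt r x y := by
  have hD : 0 < (y0 - y) ^ (-γ x) := Real.rpow_pos_of_pos (sub_pos.2 hy) _
  have hE : 0 < (y0 - y) ^ (-γt x) := Real.rpow_pos_of_pos (sub_pos.2 hy) _
  have hG : 1 / 2 ≤ 1 + d x * (y0 - y) ^ (-γt x) + r x y := by
    nlinarith [neg_abs_le (r x y), mul_le_mul_of_nonneg_right (neg_abs_le (d x)) hE.le]
  have hcx : 0 ≤ c x := hc₁.le.trans hc
  calc (y0 - y) ^ (-γ x) * (c₁ / 2) = c₁ * (y0 - y) ^ (-γ x) * (1 / 2) := by ring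
    _ ≤ c x * (y0 - y) ^ (-γ x) * (1 + d x * (y0 - y) ^ (-γt x) + r x y) := by gcongr
    _ = 1 - boundedEndCDF y0 c d γ γt r x y := by
      unfold boundedEndCDF
      ring

theorem rpow_neg_le_rpow_neg_mul_exp {s a b C h : ℝ} (hs : 0 < s) (hab : |a - b| ≤ C * h) :
    s ^ (-a) ≤ s ^ (-b) * Real.exp (C * (h * |Real.log s|)) := by
  rw [Real.rpow_def_of_pos hs, Real.rpow_def_of_pos hs, ← Real.exp_add, Real.exp_le_exp]
  have h1 : Real.log s * (b - a) ≤ |Real.log s| * |a - b| := by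
    rw [abs_sub_comm, ← abs_mul]
    exact le_abs_self _
  have h2 := mul_le_mul_of_nonneg_left hab (abs_nonneg (Real.log s))
  linarith

theorem le_rpow_neg_of_mul_rpow_le {s a b ε : ℝ} (hs : 0 < s) (h : b * s ^ a ≤ ε) :
    b ≤ ε * s ^ (-a) := by
  rw [Real.rpow_neg hs.le, ← div_eq_mul_inv]
  exact (le_div_iff₀ (Real.rpow_pos_of_pos hs a)).2 h

/-- Lemma 2(a) of the paper in the bounded-endpoint case: under Condition B(iii), for thresholds
`u_n → y_0⁻` with `T_n^{−η}·|log(y_0 − u_n)| → 0`, eventually `1 − F(x_0, u_n) > 0` and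
`T_n^{−η}·sup_{‖x−x_0‖ ≤ T_n^{−η}} ‖∇_x F(x, u_n)‖ / (1 − F(x_0, u_n)) → 0`. -/
theorem stmt_10 (p : ℕ) (hp : 1 ≤ p) (x0 : EuclideanSpace ℝ (Fin p)) (δ : ℝ) (hδ : 0 < δ)
    (y0 : ℝ) (c d γ γt : EuclideanSpace ℝ (Fin p) → ℝ)
    (r : EuclideanSpace ℝ (Fin p) → ℝ → ℝ)
    (hc : ContDiff ℝ 1 c) (hd : ContDiff ℝ 1 d)
    (hγ : ContDiff ℝ 1 γ) (hγt : ContDiff ℝ 1 γt)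
    (hcbd : ∃ c₁ c₂ : ℝ, 0 < c₁ ∧ 0 < c₂ ∧
      ∀ x ∈ Metric.closedBall x0 δ, c₁ ≤ c x ∧ c x ≤ c₂)
    (hcgrad : ∃ C : ℝ, ∀ x ∈ Metric.closedBall x0 δ, ‖fderiv ℝ c x‖ ≤ C)
    (hdbd : ∃ C : ℝ, ∀ x ∈ Metric.closedBall x0 δ, |d x| ≤ C)
    (hdgrad : ∃ C : ℝ, ∀ x ∈ Metric.closedBall x0 δ, ‖fderiv ℝ d x‖ ≤ C)
    (hγneg : ∀ x ∈ Metric.closedBall x0 δ, γ x < 0)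
    (hγtneg : ∀ x ∈ Metric.closedBall x0 δ, γt x < 0)
    (hγgrad : ∃ C : ℝ, ∀ x ∈ Metric.closedBall x0 δ, ‖fderiv ℝ γ x‖ ≤ C)
    (hγtgrad : ∃ C : ℝ, ∀ x ∈ Metric.closedBall x0 δ, ‖fderiv ℝ γt x‖ ≤ C)
    (hrx : ∀ y : ℝ, y < y0 → ContDiff ℝ 1 (fun x => r x y))
    (hr0 : ∀ ε > (0 : ℝ), ∃ y₁ < y0, ∀ y ∈ Set.Ico y₁ y0, ∀ x ∈ Metric.closedBall x0 δ,
      |r x y| * (y0 - y) ^ γt x ≤ ε)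
    (hr1 : ∀ ε > (0 : ℝ), ∃ y₁ < y0, ∀ y ∈ Set.Ico y₁ y0, ∀ x ∈ Metric.closedBall x0 δ,
      ‖fderiv ℝ (fun x' => r x' y) x‖ * (y0 - y) ^ γt x ≤ ε)
    (η : ℝ) (hη : 0 < η) (u T : ℕ → ℝ)
    (huy : ∀ n, u n < y0) (hu : Tendsto u atTop (nhds y0)) (hT : Tendsto T atTop atTop)
    (hTu : Tendsto (fun n => (T n) ^ (-η) * |Real.log (y0 - u n)|) atTop (nhds 0)) :
    (∀ᶠ n in atTop, 0 < 1 - boundedEndCDF y0 c d γ γt r x0 (u n)) ∧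
    Tendsto (fun n => (T n) ^ (-η) *
        sSup ((fun x => ‖fderiv ℝ (fun x' => boundedEndCDF y0 c d γ γt r x' (u n)) x‖) ''
          Metric.closedBall x0 ((T n) ^ (-η))) /
        (1 - boundedEndCDF y0 c d γ γt r x0 (u n)))
      atTop (nhds 0) := by
  obtain ⟨c₁, c₂, hc₁, hc₂, hcb⟩ := hcbd
  obtain ⟨C₁, hC₁⟩ := hcgrad
  obtain ⟨C₂, hC₂⟩ := hdbd
  obtain ⟨C₃, hC₃⟩ := hdgrad
  obtain ⟨C₄, hC₄⟩ := hγgrad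
  obtain ⟨C₅, hC₅⟩ := hγtgrad
  obtain ⟨C, hC⟩ := (Set.toFinite {1, c₂, C₁, C₂, C₃, C₄, C₅}).bddAbove
  simp only [upperBounds_insert, upperBounds_singleton, Set.mem_inter_iff, Set.mem_Ici] at hC
  obtain ⟨hC1, hCc, hCC₁, hCC₂, hCC₃, hCC₄, hCC₅⟩ := hC
  obtain ⟨y₁, hy₁, hr0⟩ := hr0 1 one_pos
  obtain ⟨y₂, hy₂, hr1⟩ := hr1 1 one_pos
  have hx0 : x0 ∈ Metric.closedBall x0 δ := Metric.mem_closedBall_self hδ.le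
  have hs : ∀ n, 0 < y0 - u n := fun n => sub_pos.2 (huy n)
  have hs0 : Tendsto (fun n => y0 - u n) atTop (nhds 0) := by
    simpa using hu.const_sub y0
  have hh0 : Tendsto (fun n => (T n) ^ (-η)) atTop (nhds 0) :=
    (tendsto_rpow_neg_atTop hη).comp hT
  have hsmall : ∀ᶠ n in atTop, (|d x0| + 1) * (y0 - u n) ^ (-γt x0) ≤ 1 / 2 := by
    have hpos : 0 < -γt x0 := neg_pos.2 (hγtneg x0 hx0)
    have h := (hs0.rpow_const (Or.inr hpos.le)).const_mul (|d x0| + 1)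
    rw [Real.zero_rpow hpos.ne', mul_zero] at h
    exact h.eventually_le_const (by norm_num)
  have hlow : ∀ᶠ n in atTop, (y0 - u n) ^ (-γ x0) * (c₁ / 2) ≤
      1 - boundedEndCDF y0 c d γ γt r x0 (u n) := by
    filter_upwards [hsmall, hu.eventually_const_le hy₁] with n hn hn₁
    refine le_one_sub_boundedEndCDF (huy n) hc₁ (hcb x0 hx0).1 ?_ hn
    simpa using le_rpow_neg_of_mul_rpow_le (hs n) (hr0 (u n) ⟨hn₁, huy n⟩ x0 hx0)
  have hpos : ∀ᶠ n in atTop, 0 < 1 - boundedEndCDF y0 c d γ γt r x0 (u n) := by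
    filter_upwards [hlow] with n hn
    exact (mul_pos (Real.rpow_pos_of_pos (hs n) _) (half_pos hc₁)).trans_le hn
  refine ⟨hpos, ?_⟩
  have hlim : Tendsto (fun n => 5 * C ^ 3 *
      ((T n) ^ (-η) + (T n) ^ (-η) * |Real.log (y0 - u n)|) *
      Real.exp (C * ((T n) ^ (-η) * |Real.log (y0 - u n)|)) / (c₁ / 2)) atTop (nhds 0) := by
    have h := (((hh0.add hTu).const_mul (5 * C ^ 3)).mul
      ((Real.continuous_exp.tendsto _).comp (hTu.const_mul C))).div_const (c₁ / 2)
    simpa using h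
  have hT0 : ∀ᶠ n in atTop, 0 ≤ (T n) ^ (-η) := by
    filter_upwards [hT.eventually_ge_atTop 0] with n hn
    exact Real.rpow_nonneg hn _
  refine squeeze_zero' ?_ ?_ hlim
  · filter_upwards [hpos, hT0] with n hn hTn
    refine div_nonneg (mul_nonneg hTn (Real.sSup_nonneg ?_)) hn.le
    rintro _ ⟨x, -, rfl⟩
    exact norm_nonneg _
  · filter_upwards [hlow, hT0, hh0.eventually_le_const hδ, hs0.eventually_le_const one_pos,
      hu.eventually_const_le hy₁, hu.eventually_const_le hy₂] with n hn hTn hTδ hs1 hn₁ hn₂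
    set h := (T n) ^ (-η)
    set s := y0 - u n
    set L := |Real.log s|
    have hD : 0 < s ^ (-γ x0) := Real.rpow_pos_of_pos (hs n) _
    have hL0 : 0 ≤ L := abs_nonneg _
    have hsup : sSup ((fun x => ‖fderiv ℝ (fun x' => boundedEndCDF y0 c d γ γt r x' (u n)) x‖) ''
        Metric.closedBall x0 h) ≤
        s ^ (-γ x0) * Real.exp (C * (h * L)) * (5 * C ^ 3 * (1 + L)) := by
      refine Real.sSup_le ?_ (by positivity)
      rintro _ ⟨x, hx, rfl⟩
      have hxδ := Metric.closedBall_subset_closedBall hTδ hx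
      have hγt1 : s ^ (-γt x) ≤ 1 :=
        Real.rpow_le_one (hs n).le hs1 (neg_nonneg.2 (hγtneg x hxδ).le)
      have hrb : |r x (u n)| ≤ 1 :=
        (le_rpow_neg_of_mul_rpow_le (hs n) (hr0 (u n) ⟨hn₁, huy n⟩ x hxδ)).trans (by simpa)
      have hrb' : ‖fderiv ℝ (fun z => r z (u n)) x‖ ≤ 1 :=
        (le_rpow_neg_of_mul_rpow_le (hs n) (hr1 (u n) ⟨hn₂, huy n⟩ x hxδ)).trans (by simpa)
      have hcx := hcb x hxδ
      have hγlip : |γ x - γ x0| ≤ C * h := by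
        have hmv := (convex_closedBall x0 δ).norm_image_sub_le_of_norm_fderiv_le
          (fun z _ => hγ.differentiable one_ne_zero z)
          (fun z hz => (hC₄ z hz).trans hCC₄) hx0 hxδ
        rw [Real.norm_eq_abs] at hmv
        refine hmv.trans ?_
        gcongr
        exact mem_closedBall_iff_norm.1 hx
      refine (norm_fderiv_boundedEndCDF_le (huy n) hs1 hC1
        (hc.differentiable one_ne_zero x) (hd.differentiable one_ne_zero x)
        (hγ.differentiable one_ne_zero x) (hγt.differentiable one_ne_zero x)
        ((hrx (u n) (huy n)).differentiable one_ne_zero x) (hγtneg x hxδ).le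
        (abs_le.2 ⟨by linarith, by linarith⟩) ((hC₂ x hxδ).trans hCC₂) hrb
        ((hC₁ x hxδ).trans hCC₁) ((hC₃ x hxδ).trans hCC₃) ((hC₄ x hxδ).trans hCC₄)
        ((hC₅ x hxδ).trans hCC₅) hrb').trans ?_
      gcongr
      exact rpow_neg_le_rpow_neg_mul_exp (hs n) hγlip
    calc h * sSup _ / (1 - boundedEndCDF y0 c d γ γt r x0 (u n))
        ≤ h * (s ^ (-γ x0) * Real.exp (C * (h * L)) * (5 * C ^ 3 * (1 + L))) /
          (s ^ (-γ x0) * (c₁ / 2)) := by gcongr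
      _ = 5 * C ^ 3 * (h + h * L) * Real.exp (C * (h * L)) / (c₁ / 2) := by
        field_simp
end

section
/- Under the stated second-order bounded-endpoint specification augmented with the density-level decay conditions, define f(x,y) = ∂F(x,y)/∂y. Let η > 0 and let (u_n) and (T_n) be sequences with u_n < y_0 for all n, u_n → y_0, T_n → ∞, and T_n^{−η}·|log(y_0 − u_n)| → 0. Then f(x_0, u_n) > 0 for all sufficiently large n, and T_n^{−η} · sup{ ‖∇_x f(x, u_n)‖ : ‖x − x_0‖ ≤ T_n^{−η} } / f(x_0, u_n) → 0 as n → ∞. -/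
open Filter Real

/-- The associated conditional density `f(x,y) = ∂F(x,y)/∂y`. -/
noncomputable def boundedEndPDF {p : ℕ} (y0 : ℝ) (c d γ γt : EuclideanSpace ℝ (Fin p) → ℝ)
    (r : EuclideanSpace ℝ (Fin p) → ℝ → ℝ) (x : EuclideanSpace ℝ (Fin p)) (y : ℝ) : ℝ :=
  deriv (fun y' => boundedEndCDF y0 c d γ γt r x y') y

/-- `f` is differentiable at `x`, bounded by `K` there, with gradient bounded by `K * l`. -/
structure GradBound {E : Type*} [NormedAddCommGroup E] [NormedSpace ℝ E]
    (l K : ℝ) (f : E → ℝ) (x : E) : Prop where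
  diff : DifferentiableAt ℝ f x
  abs_le : |f x| ≤ K
  norm_fderiv_le : ‖fderiv ℝ f x‖ ≤ K * l

namespace GradBound

variable {E : Type*} [NormedAddCommGroup E] [NormedSpace ℝ E] {l K K₁ K₂ : ℝ} {f g : E → ℝ} {x : E}

lemma nonneg (hf : GradBound l K f x) : 0 ≤ K := (abs_nonneg _).trans hf.abs_le

lemma of_norm_le (hl : 1 ≤ l) (hf : DifferentiableAt ℝ f x) (h₀ : |f x| ≤ K)
    (h₁ : ‖fderiv ℝ f x‖ ≤ K) : GradBound l K f x :=
  ⟨hf, h₀, h₁.trans (le_mul_of_one_le_right ((abs_nonneg _).trans h₀) hl)⟩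

lemma add (hf : GradBound l K₁ f x) (hg : GradBound l K₂ g x) :
    GradBound l (K₁ + K₂) (fun z => f z + g z) x := by
  refine ⟨hf.diff.add hg.diff, (abs_add_le _ _).trans (add_le_add hf.abs_le hg.abs_le), ?_⟩
  rw [(hf.diff.hasFDerivAt.fun_add hg.diff.hasFDerivAt).fderiv, add_mul]
  exact (norm_add_le _ _).trans (add_le_add hf.norm_fderiv_le hg.norm_fderiv_le)

lemma neg (hf : GradBound l K f x) : GradBound l K (fun z => -f z) x := by
  refine ⟨hf.diff.neg, by simpa using hf.abs_le, ?_⟩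
  rw [hf.diff.hasFDerivAt.fun_neg.fderiv, norm_neg]
  exact hf.norm_fderiv_le

lemma mul (hf : GradBound l K₁ f x) (hg : GradBound l K₂ g x) :
    GradBound l (2 * K₁ * K₂) (fun z => f z * g z) x := by
  have h₁ := hf.nonneg
  have h₂ := hg.nonneg
  refine ⟨hf.diff.mul hg.diff, ?_, ?_⟩
  · rw [abs_mul]
    nlinarith [mul_le_mul hf.abs_le hg.abs_le (abs_nonneg _) h₁, mul_nonneg h₁ h₂]
  · rw [(hf.diff.hasFDerivAt.fun_mul hg.diff.hasFDerivAt).fderiv]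
    refine (norm_add_le _ _).trans ?_
    rw [norm_smul, norm_smul, Real.norm_eq_abs, Real.norm_eq_abs]
    have e₁ := mul_le_mul hf.abs_le hg.norm_fderiv_le (norm_nonneg _) h₁
    have e₂ := mul_le_mul hg.abs_le hf.norm_fderiv_le (norm_nonneg _) h₂
    linarith

lemma norm_fderiv_rpow_le {s : ℝ} (hs : 0 < s) (hf : DifferentiableAt ℝ f x)
    (h : ‖fderiv ℝ f x‖ ≤ K) :
    ‖fderiv ℝ (fun z => s ^ f z) x‖ ≤ s ^ f x * (K * |Real.log s|) := by
  rw [(hf.hasFDerivAt.const_rpow hs).fderiv, norm_smul, norm_mul, Real.norm_eq_abs,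
    Real.norm_eq_abs, abs_of_pos (Real.rpow_pos_of_pos hs _)]
  have := (Real.rpow_pos_of_pos hs (f x)).le
  rw [mul_assoc, mul_comm K]
  gcongr

lemma rpow {s : ℝ} (hs : 0 < s) (hs1 : s ≤ 1) (hK : 1 ≤ K) (hf : DifferentiableAt ℝ f x)
    (hf0 : 0 ≤ f x) (h : ‖fderiv ℝ f x‖ ≤ K) :
    GradBound (1 + |Real.log s|) K (fun z => s ^ f z) x := by
  have h1 : s ^ f x ≤ 1 := Real.rpow_le_one hs.le hs1 hf0
  have h0 := (Real.rpow_pos_of_pos hs (f x)).le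
  refine ⟨(hf.hasFDerivAt.const_rpow hs).differentiableAt, ?_, ?_⟩
  · rw [abs_of_nonneg h0]
    exact h1.trans hK
  · refine (norm_fderiv_rpow_le hs hf h).trans ?_
    have : 0 ≤ K * |Real.log s| := by positivity
    nlinarith

/-- Gradient bound for a product with a power that is itself allowed to be large. -/
lemma norm_fderiv_rpow_mul_le {s : ℝ} (hs : 0 < s) (hf : DifferentiableAt ℝ f x)
    (h : ‖fderiv ℝ f x‖ ≤ K₁) (hg : GradBound (1 + |Real.log s|) K₂ g x) :
    ‖fderiv ℝ (fun z => s ^ f z * g z) x‖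
      ≤ s ^ f x * (K₂ * (1 + K₁) * (1 + |Real.log s|)) := by
  have hP := (Real.rpow_pos_of_pos hs (f x)).le
  have h₂ := hg.nonneg
  have h₁ : 0 ≤ K₁ := (norm_nonneg _).trans h
  have hl := abs_nonneg (Real.log s)
  rw [((hf.hasFDerivAt.const_rpow hs).differentiableAt.hasFDerivAt.fun_mul
    hg.diff.hasFDerivAt).fderiv]
  refine (norm_add_le _ _).trans ?_
  rw [norm_smul, norm_smul, Real.norm_eq_abs, Real.norm_eq_abs, abs_of_nonneg hP]
  have e₁ := mul_le_mul_of_nonneg_left hg.norm_fderiv_le hP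
  have e₂ := mul_le_mul hg.abs_le (norm_fderiv_rpow_le hs hf h) (norm_nonneg _) h₂
  nlinarith [mul_nonneg (mul_nonneg hP h₂) h₁]

end GradBound

/-- The density, with the power `(y0 - y) ^ (-γ x - 1)` factored out. -/
lemma boundedEndPDF_eq {p : ℕ} {y0 : ℝ} {c d γ γt : EuclideanSpace ℝ (Fin p) → ℝ}
    {r : EuclideanSpace ℝ (Fin p) → ℝ → ℝ} {x : EuclideanSpace ℝ (Fin p)} {y r' : ℝ}
    (hy : y < y0) (hr : HasDerivAt (fun y' => r x y') r' y) :
    boundedEndPDF y0 c d γ γt r x y = (y0 - y) ^ (-γ x - 1) *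
      (c x * (-γ x * (1 + d x * (y0 - y) ^ (-γt x) + r x y)
        + (-γt x * (d x * (y0 - y) ^ (-γt x)) + -((y0 - y) * r')))) := by
  have hs : 0 < y0 - y := sub_pos.2 hy
  have hsub : HasDerivAt (fun y' : ℝ => y0 - y') (-1) y := by
    simpa using (hasDerivAt_id y).const_sub y0
  have hpow (a : ℝ) : HasDerivAt (fun y' : ℝ => (y0 - y') ^ a) (-1 * a * (y0 - y) ^ (a - 1)) y :=
    hsub.rpow_const (Or.inl hs.ne')
  have hF := (((hpow (-γ x)).const_mul (c x)).mul
    ((((hpow (-γt x)).const_mul (d x)).const_add 1).add hr)).const_sub 1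
  have e (a : ℝ) : (y0 - y) ^ a = (y0 - y) ^ (a - 1) * (y0 - y) := by
    rw [Real.rpow_sub_one hs.ne', div_mul_cancel₀ _ hs.ne']
  refine HasDerivAt.deriv (f := fun y' => boundedEndCDF y0 c d γ γt r x y') (hF.congr_deriv ?_)
  rw [e (-γ x), e (-γt x)]
  simp only [Pi.add_apply]
  rw [e (-γt x)]
  ring

/-- A bound on `v * s ^ e` transfers to a bound on `v` by `s ^ (-e)`. -/
lemma le_mul_rpow_neg {s v e ε : ℝ} (hs : 0 < s) (h : v * s ^ e ≤ ε) : v ≤ ε * s ^ (-e) := by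
  rw [Real.rpow_neg hs.le, ← div_eq_mul_inv, le_div_iff₀ (Real.rpow_pos_of_pos hs e)]
  exact h

/-- Lemma 2(b) of the paper in the bounded-endpoint case: under Condition B(iii) augmented with
the density-level decay conditions on `∂_y r`, for thresholds `u_n → y_0⁻` with
`T_n^{−η}·|log(y_0 − u_n)| → 0`, eventually `f(x_0, u_n) > 0` and
`T_n^{−η}·sup_{‖x−x_0‖ ≤ T_n^{−η}} ‖∇_x f(x, u_n)‖ / f(x_0, u_n) → 0`. -/
theorem stmt_11 (p : ℕ) (hp : 1 ≤ p) (x0 : EuclideanSpace ℝ (Fin p)) (δ : ℝ) (hδ : 0 < δ)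
    (y0 : ℝ) (c d γ γt : EuclideanSpace ℝ (Fin p) → ℝ)
    (r ry : EuclideanSpace ℝ (Fin p) → ℝ → ℝ)
    (hc : ContDiff ℝ 1 c) (hd : ContDiff ℝ 1 d)
    (hγ : ContDiff ℝ 1 γ) (hγt : ContDiff ℝ 1 γt)
    (hcbd : ∃ c₁ c₂ : ℝ, 0 < c₁ ∧ 0 < c₂ ∧
      ∀ x ∈ Metric.closedBall x0 δ, c₁ ≤ c x ∧ c x ≤ c₂)
    (hcgrad : ∃ C : ℝ, ∀ x ∈ Metric.closedBall x0 δ, ‖fderiv ℝ c x‖ ≤ C)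
    (hdbd : ∃ C : ℝ, ∀ x ∈ Metric.closedBall x0 δ, |d x| ≤ C)
    (hdgrad : ∃ C : ℝ, ∀ x ∈ Metric.closedBall x0 δ, ‖fderiv ℝ d x‖ ≤ C)
    (hγneg : ∀ x ∈ Metric.closedBall x0 δ, γ x < 0)
    (hγtneg : ∀ x ∈ Metric.closedBall x0 δ, γt x < 0)
    (hγgrad : ∃ C : ℝ, ∀ x ∈ Metric.closedBall x0 δ, ‖fderiv ℝ γ x‖ ≤ C)
    (hγtgrad : ∃ C : ℝ, ∀ x ∈ Metric.closedBall x0 δ, ‖fderiv ℝ γt x‖ ≤ C)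
    (hrx : ∀ y : ℝ, y < y0 → ContDiff ℝ 1 (fun x => r x y))
    (hr0 : ∀ ε > (0 : ℝ), ∃ y₁ < y0, ∀ y ∈ Set.Ico y₁ y0, ∀ x ∈ Metric.closedBall x0 δ,
      |r x y| * (y0 - y) ^ γt x ≤ ε)
    (hr1 : ∀ ε > (0 : ℝ), ∃ y₁ < y0, ∀ y ∈ Set.Ico y₁ y0, ∀ x ∈ Metric.closedBall x0 δ,
      ‖fderiv ℝ (fun x' => r x' y) x‖ * (y0 - y) ^ γt x ≤ ε)
    -- `r` is continuously differentiable in `y`, with derivative `ry`: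
    (hry : ∀ x : EuclideanSpace ℝ (Fin p), ∀ y : ℝ, y < y0 →
      HasDerivAt (fun y' => r x y') (ry x y) y)
    (hrycont : ∀ x : EuclideanSpace ℝ (Fin p),
      ContinuousOn (fun y => ry x y) (Set.Iio y0))
    -- `∇_x ∂_y r` exists and is continuous:
    (hryx : ∀ y : ℝ, y < y0 → ContDiff ℝ 1 (fun x => ry x y))
    (hry0 : ∀ ε > (0 : ℝ), ∃ y₁ < y0, ∀ y ∈ Set.Ico y₁ y0, ∀ x ∈ Metric.closedBall x0 δ,
      |ry x y| * (y0 - y) ^ (γt x + 1) ≤ ε)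
    (hry1 : ∀ ε > (0 : ℝ), ∃ y₁ < y0, ∀ y ∈ Set.Ico y₁ y0, ∀ x ∈ Metric.closedBall x0 δ,
      ‖fderiv ℝ (fun x' => ry x' y) x‖ * (y0 - y) ^ (γt x + 1) ≤ ε)
    (η : ℝ) (hη : 0 < η) (u T : ℕ → ℝ)
    (huy : ∀ n, u n < y0) (hu : Tendsto u atTop (nhds y0)) (hT : Tendsto T atTop atTop)
    (hTu : Tendsto (fun n => (T n) ^ (-η) * |Real.log (y0 - u n)|) atTop (nhds 0)) :
    (∀ᶠ n in atTop, 0 < boundedEndPDF y0 c d γ γt r x0 (u n)) ∧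
    Tendsto (fun n => (T n) ^ (-η) *
        sSup ((fun x => ‖fderiv ℝ (fun x' => boundedEndPDF y0 c d γ γt r x' (u n)) x‖) ''
          Metric.closedBall x0 ((T n) ^ (-η))) /
        boundedEndPDF y0 c d γ γt r x0 (u n))
      atTop (nhds 0) := by
  obtain ⟨c₁, c₂, hc₁, -, hcb⟩ := hcbd
  obtain ⟨C₁, hC₁⟩ := hcgrad
  obtain ⟨C₂, hC₂⟩ := hdbd
  obtain ⟨C₃, hC₃⟩ := hdgrad
  obtain ⟨C₄, hC₄⟩ := hγgrad
  obtain ⟨C₅, hC₅⟩ := hγtgrad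
  have hcomp := isCompact_closedBall x0 δ
  obtain ⟨C₆, hC₆⟩ := hcomp.exists_bound_of_continuousOn hγ.continuous.continuousOn
  obtain ⟨C₇, hC₇⟩ := hcomp.exists_bound_of_continuousOn hγt.continuous.continuousOn
  obtain ⟨K, hK⟩ : ∃ K : ℝ, ∀ z ∈ ({1, c₂, C₁, C₂, C₃, C₄, C₅, C₆, C₇} : Finset ℝ), z ≤ K :=
    Finset.exists_le _
  simp only [Finset.mem_insert, Finset.mem_singleton, forall_eq_or_imp, forall_eq] at hK
  obtain ⟨k1, kc, k₁, k₂, k₃, k₄, k₅, k₆, k₇⟩ := hK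
  have hx0 : x0 ∈ Metric.closedBall x0 δ := Metric.mem_closedBall_self hδ.le
  have hdiff {g : EuclideanSpace ℝ (Fin p) → ℝ} (hg : ContDiff ℝ 1 g) (x) :
      DifferentiableAt ℝ g x := hg.differentiable one_ne_zero x
  have hnear {P : ℝ → Prop} (h : ∃ y₁ < y0, ∀ y ∈ Set.Ico y₁ y0, P y) : ∀ᶠ n in atTop, P (u n) := by
    obtain ⟨y₁, hy₁, h⟩ := h
    filter_upwards [hu.eventually_const_lt hy₁] with n hn using h _ ⟨hn.le, huy n⟩
  have hs : Tendsto (fun n => y0 - u n) atTop (nhds 0) := by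
    simpa using hu.const_sub y0
  have hs1 : ∀ᶠ n in atTop, y0 - u n ≤ 1 := hs.eventually_le_const one_pos
  have hpdf n x := boundedEndPDF_eq (c := c) (d := d) (γ := γ) (γt := γt) (huy n) (hry x _ (huy n))
  -- lower bound for the density at `x0`
  have hlow : ∀ᶠ n in atTop, (y0 - u n) ^ (-γ x0 - 1) * (c₁ * (-γ x0 / 2))
      ≤ boundedEndPDF y0 c d γ γt r x0 (u n) := by
    have hpow : Tendsto (fun n => (y0 - u n) ^ (-γt x0) *
        (-γ x0 * |d x0| + -γ x0 + -γt x0 * |d x0| + 1)) atTop (nhds 0) := by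
      have := (hs.rpow_const (p := -γt x0) (Or.inr (by linarith [hγtneg x0 hx0]))).mul_const
        (-γ x0 * |d x0| + -γ x0 + -γt x0 * |d x0| + 1)
      rwa [Real.zero_rpow (by linarith [hγtneg x0 hx0]), zero_mul] at this
    have ha : 0 < -γ x0 := by linarith [hγneg x0 hx0]
    have hb : 0 < -γt x0 := by linarith [hγtneg x0 hx0]
    filter_upwards [hpow.eventually_le_const (half_pos ha), hnear (hr0 1 one_pos),
      hnear (hry0 1 one_pos)] with n h1 h2 h3
    have hsn : 0 < y0 - u n := sub_pos.2 (huy n)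
    rw [hpdf n x0]
    have hP := Real.rpow_pos_of_pos hsn (-γ x0 - 1)
    have hB := Real.rpow_pos_of_pos hsn (-γt x0)
    have r0 := le_mul_rpow_neg hsn (h2 x0 hx0)
    have r1 := le_mul_rpow_neg hsn
      (show ((y0 - u n) * |ry x0 (u n)|) * (y0 - u n) ^ γt x0 ≤ 1 by
        refine le_trans (le_of_eq ?_) (h3 x0 hx0)
        rw [Real.rpow_add_one hsn.ne']
        ring)
    generalize (y0 - u n) ^ (-γt x0) = B at *
    refine mul_le_mul_of_nonneg_left ?_ hP.le
    refine mul_le_mul (hcb x0 hx0).1 ?_ (half_pos ha).le (hc₁.le.trans (hcb x0 hx0).1)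
    have q1 := mul_le_mul_of_nonneg_left (neg_abs_le (d x0)) (mul_pos ha hB).le
    have q2 := mul_le_mul_of_nonneg_left (neg_abs_le (d x0)) (mul_pos hb hB).le
    have q3 := mul_le_mul_of_nonneg_left ((neg_le_neg r0).trans (neg_abs_le (r x0 (u n)))) ha.le
    have q4 := mul_le_mul_of_nonneg_left (le_abs_self (ry x0 (u n))) hsn.le
    linarith
  -- upper bound for the gradient on the ball
  obtain ⟨M, hM0, hM⟩ : ∃ M : ℝ, 0 ≤ M ∧ ∀ᶠ n in atTop, ∀ x ∈ Metric.closedBall x0 δ,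
      ‖fderiv ℝ (fun x' => boundedEndPDF y0 c d γ γt r x' (u n)) x‖
        ≤ (y0 - u n) ^ (-γ x - 1) * (M * (1 + |Real.log (y0 - u n)|)) := by
    refine ⟨2 * K * (2 * K * (K + 2 * K * K + K) + (2 * K * (2 * K * K) + K)) * (1 + K),
      by positivity, ?_⟩
    filter_upwards [hs1, hnear (hr0 1 one_pos), hnear (hry0 1 one_pos), hnear (hr1 1 one_pos),
      hnear (hry1 1 one_pos)] with n hn h0 h0' h1 h1' x hx
    have hsn : 0 < y0 - u n := sub_pos.2 (huy n)
    have hl : 1 ≤ 1 + |Real.log (y0 - u n)| := le_add_of_nonneg_right (abs_nonneg _)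
    have hpow : (y0 - u n) ^ (-γt x) ≤ 1 :=
      Real.rpow_le_one hsn.le hn (by linarith [hγtneg x hx])
    have hbd {v : ℝ} (h : v * (y0 - u n) ^ γt x ≤ 1) : v ≤ K := by
      have := le_mul_rpow_neg hsn h
      linarith
    have hbd' {v : ℝ} (h : v * (y0 - u n) ^ (γt x + 1) ≤ 1) : (y0 - u n) * v ≤ K := by
      refine hbd (le_trans (le_of_eq ?_) h)
      rw [Real.rpow_add_one hsn.ne']
      ring
    simp only [hpdf n]
    have nγ : ‖fderiv ℝ (fun z => -γ z) x‖ ≤ K := by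
      rw [fderiv_fun_neg, norm_neg]
      exact (hC₄ x hx).trans k₄
    have nγt : ‖fderiv ℝ (fun z => -γt z) x‖ ≤ K := by
      rw [fderiv_fun_neg, norm_neg]
      exact (hC₅ x hx).trans k₅
    have bc : GradBound (1 + |Real.log (y0 - u n)|) K c x :=
      .of_norm_le hl (hdiff hc x)
        (abs_le.2 ⟨by linarith [(hcb x hx).1], (hcb x hx).2.trans kc⟩) ((hC₁ x hx).trans k₁)
    have bd : GradBound (1 + |Real.log (y0 - u n)|) K d x :=
      .of_norm_le hl (hdiff hd x) ((hC₂ x hx).trans k₂) ((hC₃ x hx).trans k₃)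
    have bγ : GradBound (1 + |Real.log (y0 - u n)|) K (fun z => -γ z) x :=
      .of_norm_le hl (hdiff hγ x).neg (by simpa using (hC₆ x hx).trans k₆) nγ
    have bγt : GradBound (1 + |Real.log (y0 - u n)|) K (fun z => -γt z) x :=
      .of_norm_le hl (hdiff hγt x).neg (by simpa using (hC₇ x hx).trans k₇) nγt
    have bpow := GradBound.rpow hsn hn k1 (hdiff hγt x).neg (by simpa using (hγtneg x hx).le) nγt
    have br : GradBound (1 + |Real.log (y0 - u n)|) K (fun z => r z (u n)) x :=
      .of_norm_le hl (hdiff (hrx _ (huy n)) x) (hbd (h0 x hx)) (hbd (h1 x hx))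
    have bry : GradBound (1 + |Real.log (y0 - u n)|) K (fun z => (y0 - u n) * ry z (u n)) x := by
      refine .of_norm_le hl ((hdiff (hryx _ (huy n)) x).const_mul _) ?_ ?_
      · rw [abs_mul, abs_of_pos hsn]
        exact hbd' (h0' x hx)
      · rw [fderiv_const_mul (hdiff (hryx _ (huy n)) x), norm_smul, Real.norm_eq_abs,
          abs_of_pos hsn]
        exact hbd' (h1' x hx)
    have bone : GradBound (1 + |Real.log (y0 - u n)|) K
        (fun _ : EuclideanSpace ℝ (Fin p) => (1 : ℝ)) x :=
      .of_norm_le hl (differentiableAt_const _) (by simpa using k1)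
        (by simpa using zero_le_one.trans k1)
    refine GradBound.norm_fderiv_rpow_mul_le hsn ((hdiff hγ x).neg.sub_const 1) ?_
      (bc.mul ((bγ.mul ((bone.add (bd.mul bpow)).add br)).add
        ((bγt.mul (bd.mul bpow)).add bry.neg)))
    rw [fderiv_sub_const]
    exact nγ
  have ha : 0 < c₁ * (-γ x0 / 2) := mul_pos hc₁ (by linarith [hγneg x0 hx0])
  have hpos : ∀ᶠ n in atTop, 0 < boundedEndPDF y0 c d γ γt r x0 (u n) := by
    filter_upwards [hlow] with n hn
    exact (mul_pos (Real.rpow_pos_of_pos (sub_pos.2 (huy n)) _) ha).trans_le hn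
  refine ⟨hpos, ?_⟩
  have hT0 : Tendsto (fun n => (T n) ^ (-η)) atTop (nhds 0) :=
    (tendsto_rpow_neg_atTop hη).comp hT
  have hlim : Tendsto (fun n => Real.exp (K * ((T n) ^ (-η) * |Real.log (y0 - u n)|)) *
      (M / (c₁ * (-γ x0 / 2))) * ((T n) ^ (-η) + (T n) ^ (-η) * |Real.log (y0 - u n)|))
      atTop (nhds 0) := by
    have h := (((Real.continuous_exp.tendsto _).comp (hTu.const_mul K)).mul_const
      (M / (c₁ * (-γ x0 / 2)))).mul (hT0.add hTu)
    simpa using h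
  refine squeeze_zero' ?_ ?_ hlim
  · filter_upwards [hpos, hT.eventually_ge_atTop 0] with n hn hTn
    refine div_nonneg (mul_nonneg (Real.rpow_nonneg hTn _) (Real.sSup_nonneg ?_)) hn.le
    rintro _ ⟨x, -, rfl⟩
    exact norm_nonneg _
  filter_upwards [hpos, hlow, hM, hT.eventually_ge_atTop 0, hT0.eventually_le_const hδ]
    with n hn hl hm hTn hTδ
  have ht := Real.rpow_nonneg hTn (-η)
  have hsn : 0 < y0 - u n := sub_pos.2 (huy n)
  set t := (T n) ^ (-η)
  set s := y0 - u n
  have hsup : sSup ((fun x => ‖fderiv ℝ (fun x' => boundedEndPDF y0 c d γ γt r x' (u n)) x‖) ''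
      Metric.closedBall x0 t) ≤
      s ^ (-γ x0 - 1) * Real.exp (K * (t * |Real.log s|)) * (M * (1 + |Real.log s|)) := by
    refine Real.sSup_le ?_ (by positivity)
    rintro _ ⟨x, hx, rfl⟩
    have hxδ := Metric.closedBall_subset_closedBall hTδ hx
    refine (hm x hxδ).trans (mul_le_mul_of_nonneg_right ?_ (by positivity))
    have hlip : ‖γ x - γ x0‖ ≤ K * ‖x - x0‖ :=
      (convex_closedBall x0 δ).norm_image_sub_le_of_norm_fderiv_le
        (fun z _ => hdiff hγ z) (fun z hz => (hC₄ z hz).trans k₄) hx0 hxδ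
    have hdist : ‖x - x0‖ ≤ t := mem_closedBall_iff_norm.1 hx
    rw [Real.rpow_def_of_pos hsn, Real.rpow_def_of_pos hsn, ← Real.exp_add, Real.exp_le_exp]
    have h1 : |γ x - γ x0| ≤ K * t := hlip.trans (by gcongr)
    have h2 : -(Real.log s * (γ x - γ x0)) ≤ |Real.log s| * (K * t) := by
      refine (neg_le_abs _).trans ?_
      rw [abs_mul]
      gcongr
    linarith
  rw [div_le_iff₀ hn]
  calc _ ≤ t * (s ^ (-γ x0 - 1) * Real.exp (K * (t * |Real.log s|)) * (M * (1 + |Real.log s|))) :=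
        mul_le_mul_of_nonneg_left hsup ht
    _ = Real.exp (K * (t * |Real.log s|)) * (M / (c₁ * (-γ x0 / 2))) * (t + t * |Real.log s|) *
          (s ^ (-γ x0 - 1) * (c₁ * (-γ x0 / 2))) := by
        have hA := ha.ne'
        generalize c₁ * (-γ x0 / 2) = A at hA ⊢
        field_simp
    _ ≤ _ := mul_le_mul_of_nonneg_left hl (by positivity)
end

section
/- Let a > 0 and b, K ∈ ℝ, and let (t_n)_{n≥1} be a sequence of real numbers with t_n → ∞ and a·t_n² − b·t_n ≥ log n − K for all n ≥ 1. Then n · ∫_{t_n}^∞ exp(−a·s² + b·s) ds → 0 as n → ∞. -/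
open Real Filter MeasureTheory

/-- Mills-type bound for a Gaussian tail: the exponent lies below its tangent line at `t`. -/
theorem setIntegral_Ici_exp_quadratic_le {a : ℝ} (ha : 0 ≤ a) {b t : ℝ} (hc : 0 < 2 * a * t - b) :
    ∫ s in Set.Ici t, Real.exp (-a * s ^ 2 + b * s) ≤
      Real.exp (-(a * t ^ 2 - b * t)) / (2 * a * t - b) := by
  have hneg : -(2 * a * t - b) < 0 := by linarith
  rw [integral_Ici_eq_integral_Ioi]
  calc ∫ s in Set.Ioi t, Real.exp (-a * s ^ 2 + b * s)
      ≤ ∫ s in Set.Ioi t, Real.exp (a * t ^ 2) * Real.exp (-(2 * a * t - b) * s) := by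
        refine integral_mono_of_nonneg (ae_of_all _ fun s => (Real.exp_pos _).le)
          ((integrableOn_exp_mul_Ioi hneg t).const_mul _) (ae_of_all _ fun s => ?_)
        simp only [← Real.exp_add]
        exact Real.exp_le_exp.2 (by nlinarith [mul_nonneg ha (sq_nonneg (s - t))])
    _ = Real.exp (-(a * t ^ 2 - b * t)) / (2 * a * t - b) := by
        rw [integral_const_mul, integral_exp_mul_Ioi hneg, neg_div_neg_eq, ← mul_div_assoc,
          ← Real.exp_add]
        ring_nf

/-- If `a > 0`, `t_n → ∞`, and `a·t_n² − b·t_n ≥ log n − K` for all `n ≥ 1`, then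
`n·∫_{t_n}^∞ exp(−a·s² + b·s) ds → 0`. -/
theorem stmt_14 (a : ℝ) (ha : 0 < a) (b K : ℝ) (t : ℕ → ℝ)
    (ht : Tendsto t atTop atTop)
    (hlb : ∀ n : ℕ, 1 ≤ n → Real.log n - K ≤ a * (t n) ^ 2 - b * t n) :
    Tendsto (fun n : ℕ => (n : ℝ) * ∫ s in Set.Ici (t n), Real.exp (-a * s ^ 2 + b * s))
      atTop (nhds 0) := by
  have hslope : Tendsto (fun n => 2 * a * t n - b) atTop atTop :=
    tendsto_atTop_add_const_right _ (-b) (ht.const_mul_atTop (by positivity))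
  refine squeeze_zero' (Eventually.of_forall fun n => ?_) ?_
    (hslope.const_div_atTop (Real.exp K))
  · exact mul_nonneg n.cast_nonneg (integral_nonneg fun s => (Real.exp_pos _).le)
  · filter_upwards [eventually_ge_atTop 1, hslope.eventually_gt_atTop 0] with n hn hc
    have hn0 : (0 : ℝ) < n := by exact_mod_cast hn
    calc (n : ℝ) * ∫ s in Set.Ici (t n), Real.exp (-a * s ^ 2 + b * s)
        ≤ n * (Real.exp (-(a * t n ^ 2 - b * t n)) / (2 * a * t n - b)) := by
          gcongr
          exact setIntegral_Ici_exp_quadratic_le ha.le hc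
      _ = Real.exp (Real.log n - (a * t n ^ 2 - b * t n)) / (2 * a * t n - b) := by
          rw [sub_eq_add_neg (Real.log n), Real.exp_add, Real.exp_log hn0, mul_div_assoc]
      _ ≤ Real.exp K / (2 * a * t n - b) := by
          gcongr
          linarith [hlb n hn]
end
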